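/- (Kloeden: Sharkovsky's theorem for triangular maps.) Let T(x,y) = (f(x), g(x,y)) be a continuous triangular map on I × I. If T has a periodic point of minimal period m and m >_s k in the Sharkovsky ordering, then T has a periodic point of minimal period k. -/

import Mathlib

open Function

/-- The unit interval `[0,1]`. -/
local notation "I" => unitInterval

/-- The triangular map `T(x,y) = (f x, g (x,y))` on `I × I`. -/
def triMap (f : I → I) (g : I × I → I) : I × I → I × I :=
  fun z => (f z.1, g z)

/-- `z` is a periodic point of `F` of minimal period `n`:
`F^[n] z = z` and `F^[k] z ≠ z` for `0 < k < n`. -/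
def MinPeriod {X : Type*} (F : X → X) (z : X) (n : ℕ) : Prop :=
  0 < n ∧ F^[n] z = z ∧ ∀ k, 0 < k → k < n → F^[k] z ≠ z

/-- The Sharkovsky ordering: writing `m = 2^a * m'` and `k = 2^c * k'` with `m', k'` odd,
`m >_s k` iff (i) `m' > 1`, `k' > 1` and (`a < c`, or `a = c` and `m' < k'`); or
(ii) `m' > 1` and `k' = 1`; or (iii) `m' = k' = 1` and `a > c`. -/
def SharkGt (m k : ℕ) : Prop :=
  ∃ a m' c k' : ℕ, Odd m' ∧ Odd k' ∧ m = 2 ^ a * m' ∧ k = 2 ^ c * k' ∧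
    ((1 < m' ∧ 1 < k' ∧ (a < c ∨ (a = c ∧ m' < k'))) ∨
     (1 < m' ∧ k' = 1) ∨
     (m' = 1 ∧ k' = 1 ∧ c < a))

open Set in
/-- The last point of `[u, a]` at which a continuous function is at most `z`. -/
theorem exists_last_eq {f : ℝ → ℝ} (hf : Continuous f) {u a z : ℝ} (hua : u ≤ a)
    (hu : f u ≤ z) (ha : z < f a) :
    ∃ v, u ≤ v ∧ v < a ∧ f v = z ∧ ∀ t, v < t → t ≤ a → z < f t := by
  have hcomp : IsCompact (Icc u a ∩ f ⁻¹' Iic z) :=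
    isCompact_Icc.inter_right (isClosed_Iic.preimage hf)
  obtain ⟨v, ⟨⟨huv, hva⟩, hv⟩, hmax⟩ :=
    hcomp.exists_isGreatest ⟨u, ⟨le_rfl, hua⟩, hu⟩
  have hgt : ∀ t, v < t → t ≤ a → z < f t := by
    intro t hvt hta
    by_contra! h
    exact absurd (hmax ⟨⟨huv.trans hvt.le, hta⟩, h⟩) (not_le.2 hvt)
  have hva' : v < a := lt_of_le_of_ne hva (by rintro rfl; exact absurd ha (not_lt.2 hv))
  refine ⟨v, huv, hva', le_antisymm hv ?_, hgt⟩
  obtain ⟨t, ⟨hvt, hta⟩, ht⟩ :=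
    intermediate_value_Icc hva hf.continuousOn (⟨hv, ha.le⟩ : z ∈ Icc (f v) (f a))
  rcases hvt.eq_or_lt with rfl | h
  · exact ht.ge
  · exact absurd (hgt t h hta) (by rw [ht]; exact lt_irrefl z)

open Set in
theorem exists_Icc_image_eq_of_le {f : ℝ → ℝ} (hf : Continuous f) {p q : ℝ} (hpq : p ≤ q)
    (hfpq : f p ≤ f q) :
    ∃ a b, p ≤ a ∧ a ≤ b ∧ b ≤ q ∧ f '' Icc a b = Icc (f p) (f q) := by
  have hcb : IsCompact (Icc p q ∩ f ⁻¹' Ici (f q)) :=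
    isCompact_Icc.inter_right (isClosed_Ici.preimage hf)
  obtain ⟨b, ⟨⟨hpb, hbq⟩, hb⟩, hbmin⟩ := hcb.exists_isLeast ⟨q, ⟨hpq, le_rfl⟩, le_refl (f q)⟩
  have hblt : ∀ t, p ≤ t → t < b → f t < f q := by
    intro t hpt htb
    by_contra! h
    exact absurd (hbmin ⟨⟨hpt, htb.le.trans hbq⟩, h⟩) (not_le.2 htb)
  have hfb : f b = f q := by
    refine le_antisymm ?_ hb
    obtain ⟨t, ⟨hpt, htb⟩, ht⟩ :=
      intermediate_value_Icc hpb hf.continuousOn (⟨hfpq, hb⟩ : f q ∈ Icc (f p) (f b))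
    rcases htb.eq_or_lt with rfl | h
    · exact ht.le
    · exact absurd (hblt t hpt h) (by rw [ht]; exact lt_irrefl _)
  have hca : IsCompact (Icc p b ∩ f ⁻¹' Iic (f p)) :=
    isCompact_Icc.inter_right (isClosed_Iic.preimage hf)
  obtain ⟨a, ⟨⟨hpa, hab⟩, ha⟩, hamax⟩ := hca.exists_isGreatest ⟨p, ⟨le_rfl, hpb⟩, le_refl (f p)⟩
  have hagt : ∀ t, a < t → t ≤ b → f p < f t := by
    intro t hat htb
    by_contra! h
    exact absurd (hamax ⟨⟨hpa.trans hat.le, htb⟩, h⟩) (not_le.2 hat)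
  have hfa : f a = f p := by
    refine le_antisymm ha ?_
    obtain ⟨t, ⟨hat, htb⟩, ht⟩ := intermediate_value_Icc hab hf.continuousOn
      (⟨ha, hfb ▸ hfpq⟩ : f p ∈ Icc (f a) (f b))
    rcases hat.eq_or_lt with rfl | h
    · exact ht.ge
    · exact absurd (hagt t h htb) (by rw [ht]; exact lt_irrefl _)
  refine ⟨a, b, hpa, hab, hbq, Subset.antisymm ?_ ?_⟩
  · rintro _ ⟨t, ⟨hat, htb⟩, rfl⟩
    constructor
    · rcases hat.eq_or_lt with rfl | h
      · exact hfa.ge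
      · exact (hagt t h htb).le
    · rcases htb.eq_or_lt with rfl | h
      · exact hfb.le
      · exact (hblt t (hpa.trans hat) h).le
  · have := intermediate_value_Icc hab hf.continuousOn
    rwa [hfa, hfb] at this

open Set in
/-- If `f` maps `[a, b]` over `[c, d]`, then some subinterval is mapped exactly onto `[c, d]`. -/
theorem exists_Icc_image_eq {f : ℝ → ℝ} (hf : Continuous f) {a b c d : ℝ} (hcd : c ≤ d)
    (h : SurjOn f (Icc a b) (Icc c d)) :
    ∃ a' b', a ≤ a' ∧ a' ≤ b' ∧ b' ≤ b ∧ f '' Icc a' b' = Icc c d := by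
  obtain ⟨p, hp, rfl⟩ := h (left_mem_Icc.2 hcd)
  obtain ⟨q, hq, rfl⟩ := h (right_mem_Icc.2 hcd)
  rcases le_total p q with hpq | hqp
  · obtain ⟨a', b', h1, h2, h3, h4⟩ := exists_Icc_image_eq_of_le hf hpq hcd
    exact ⟨a', b', hp.1.trans h1, h2, h3.trans hq.2, h4⟩
  · obtain ⟨a', b', h1, h2, h3, h4⟩ :=
      exists_Icc_image_eq_of_le hf.neg hqp (neg_le_neg hcd)
    change (fun x => -f x) '' Icc a' b' = Icc (-f q) (-f p) at h4
    refine ⟨a', b', hq.1.trans h1, h2, h3.trans hp.2, ?_⟩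
    have h5 : f '' Icc a' b' = (fun x => -x) '' ((fun x => -f x) '' Icc a' b') := by
      rw [image_image]; simp
    rw [h5, h4]; simp

open Set in
theorem exists_Icc_image_iterate_eq {f : ℝ → ℝ} (hf : Continuous f) {a b : ℝ} (hab : a ≤ b)
    (h : SurjOn f (Icc a b) (Icc a b)) (n : ℕ) :
    ∃ a' b', a ≤ a' ∧ a' ≤ b' ∧ b' ≤ b ∧ f^[n] '' Icc a' b' = Icc a b ∧
      ∀ i ≤ n, ∀ t ∈ Icc a' b', f^[i] t ∈ Icc a b := by
  induction n with
  | zero =>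
    refine ⟨a, b, le_rfl, hab, le_rfl, by simp, ?_⟩
    intro i hi t ht
    obtain rfl : i = 0 := by omega
    exact ht
  | succ n ih =>
    obtain ⟨a₁, b₁, h1, h2, h3, h4, h5⟩ := ih
    have hs : SurjOn f^[n + 1] (Icc a₁ b₁) (Icc a b) := by
      rw [iterate_succ', SurjOn, image_comp, h4]; exact h
    obtain ⟨a₂, b₂, k1, k2, k3, k4⟩ := exists_Icc_image_eq (hf.iterate _) hab hs
    refine ⟨a₂, b₂, h1.trans k1, k2, k3.trans h3, k4, ?_⟩
    intro i hi t ht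
    rcases Nat.lt_or_ge i (n + 1) with h | h
    · exact h5 i (by omega) t ⟨k1.trans ht.1, ht.2.trans k3⟩
    · obtain rfl : i = n + 1 := by omega
      rw [← k4]; exact mem_image_of_mem _ ht

open Set in
/-- A loop of intervals `K → K → ⋯ → K → D → K`, where `K` covers itself under `f`,
covers `D` under `f^[j]` and is covered by `D` under `f`, is followed by a periodic point. -/
theorem exists_periodic_of_loop {f : ℝ → ℝ} (hf : Continuous f) {a b c d : ℝ} (hab : a ≤ b)
    (hcd : c ≤ d) {j : ℕ} (hK : SurjOn f (Icc a b) (Icc a b))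
    (hKD : SurjOn f^[j] (Icc a b) (Icc c d)) (hDK : SurjOn f (Icc c d) (Icc a b)) (n : ℕ) :
    ∃ y, (∀ i ≤ n, f^[i] y ∈ Icc a b) ∧ f^[n + j] y ∈ Icc c d ∧ f^[n + j + 1] y = y := by
  obtain ⟨a₁, b₁, h1, h2, h3, h4, h5⟩ := exists_Icc_image_iterate_eq hf hab hK n
  have hs : SurjOn f^[n + j] (Icc a₁ b₁) (Icc c d) := by
    rw [add_comm, iterate_add, SurjOn, image_comp, h4]; exact hKD
  obtain ⟨a₂, b₂, k1, k2, k3, k4⟩ := exists_Icc_image_eq (hf.iterate _) hcd hs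
  have hs' : SurjOn f^[n + j + 1] (Icc a₂ b₂) (Icc a₂ b₂) := by
    rw [iterate_succ', SurjOn, image_comp, k4]
    exact (Icc_subset_Icc (h1.trans k1) (k3.trans h3)).trans hDK
  obtain ⟨y, hy, hfix⟩ :=
    exists_mem_Icc_isFixedPt_of_surjOn (hf.iterate _).continuousOn k2 hs'
  refine ⟨y, fun i hi => h5 i hi y ⟨k1.trans hy.1, hy.2.trans k3⟩, ?_, hfix⟩
  rw [← k4]; exact mem_image_of_mem _ hy

/-- `f` has a point of minimal period `n`. -/
def HasMinPeriod {X : Type*} (f : X → X) (n : ℕ) : Prop :=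
  ∃ x, minimalPeriod f x = n

theorem surjOn_Icc_of_le_of_ge {f : ℝ → ℝ} (hf : Continuous f) {a b p q c d : ℝ}
    (hp : p ∈ Set.Icc a b) (hq : q ∈ Set.Icc a b) (hfp : f p ≤ c) (hfq : d ≤ f q) :
    Set.SurjOn f (Set.Icc a b) (Set.Icc c d) := by
  intro y hy
  obtain ⟨x, hx, rfl⟩ := isPreconnected_Icc.intermediate_value hp hq hf.continuousOn
    (⟨hfp.trans hy.1, hy.2.trans hfq⟩ : y ∈ Set.Icc (f p) (f q))
  exact ⟨x, hx, rfl⟩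

theorem hasMinPeriod_three_of_horseshoe {h : ℝ → ℝ} (hh : Continuous h) {a u b : ℝ}
    (hau : a < u) (hub : u < b) (ha : b ≤ h a) (hu : h u ≤ a) (hb : b ≤ h b) :
    HasMinPeriod h 3 := by
  have hK : Set.SurjOn h (Set.Icc u b) (Set.Icc u b) :=
    surjOn_Icc_of_le_of_ge hh ⟨le_rfl, hub.le⟩ ⟨hub.le, le_rfl⟩ (hu.trans hau.le) hb
  have hKD : Set.SurjOn h^[1] (Set.Icc u b) (Set.Icc a u) :=
    surjOn_Icc_of_le_of_ge hh ⟨le_rfl, hub.le⟩ ⟨hub.le, le_rfl⟩ hu (hub.le.trans hb)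
  have hDK : Set.SurjOn h (Set.Icc a u) (Set.Icc u b) :=
    surjOn_Icc_of_le_of_ge hh ⟨hau.le, le_rfl⟩ ⟨le_rfl, hau.le⟩ (hu.trans hau.le) ha
  obtain ⟨y, hy1, hy2, hy3⟩ := exists_periodic_of_loop hh hub.le hau.le hK hKD hDK 1
  refine ⟨y, ?_⟩
  have : Fact (Nat.Prime 3) := ⟨Nat.prime_three⟩
  refine minimalPeriod_eq_prime hy3 ?_
  intro hfix
  have h2 : h^[2] y = y := hfix.iterate 2
  have h0 := hy1 0 (by norm_num)
  rw [h2] at hy2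
  obtain rfl : y = u := le_antisymm hy2.2 h0.1
  have : h y = y := hfix
  linarith

theorem hasMinPeriod_two_of_fixed {f : ℝ → ℝ} {y : ℝ} (h2 : f (f y) = y) (h1 : f y ≠ y) :
    HasMinPeriod f 2 := by
  have : Fact (Nat.Prime 2) := ⟨Nat.prime_two⟩
  exact ⟨y, minimalPeriod_eq_prime h2 h1⟩

theorem periods_of_left_escape {f : ℝ → ℝ} (hf : Continuous f) {v q a z : ℝ}
    (haz : a < z) (hz : f z = z) (hvq : v < q) (hqa : q ≤ a) (hv : f v = z)
    (hgt : ∀ t, v < t → t ≤ a → z < f t) (hq : f (f q) ≤ v) :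
    HasMinPeriod f 2 ∧ HasMinPeriod f^[2] 3 := by
  constructor
  · obtain ⟨y, hy, hfix⟩ := exists_mem_Icc_isFixedPt (f := f^[2]) (hf.iterate 2).continuousOn
      hvq.le (by simp only [iterate_succ, iterate_zero, comp_apply, id, hv, hz]; linarith)
      (hq.trans hvq.le)
    have hy2 : f (f y) = y := hfix
    refine hasMinPeriod_two_of_fixed hy2 ?_
    have hvy : v < y := by
      refine lt_of_le_of_ne hy.1 ?_
      rintro rfl
      rw [hv, hz] at hy2
      linarith
    have := hgt y hvy (hy.2.trans hqa)
    have := hy.2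
    intro h; linarith
  · refine hasMinPeriod_three_of_horseshoe (hf.iterate 2) hvq (hqa.trans_lt haz) ?_ hq ?_
    · simp [hv, hz]
    · simp [hz]

/-- Reflection of a self-map of the line in the origin. -/
def reflect (f : ℝ → ℝ) : ℝ → ℝ := fun x => -f (-x)

theorem reflect_iterate (f : ℝ → ℝ) (n : ℕ) : (reflect f)^[n] = reflect f^[n] := by
  induction n with
  | zero => funext x; simp [reflect]
  | succ n ih => rw [iterate_succ', ih, iterate_succ']; funext x; simp [reflect]

theorem minimalPeriod_reflect (f : ℝ → ℝ) (x : ℝ) :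
    minimalPeriod (reflect f) x = minimalPeriod f (-x) := by
  rw [minimalPeriod_eq_minimalPeriod_iff]
  intro n
  simp only [IsPeriodicPt, IsFixedPt, reflect_iterate]
  simp only [reflect, neg_eq_iff_eq_neg]

theorem hasMinPeriod_reflect {f : ℝ → ℝ} {n : ℕ} :
    HasMinPeriod (reflect f) n ↔ HasMinPeriod f n := by
  constructor
  · rintro ⟨x, hx⟩; exact ⟨-x, by rwa [minimalPeriod_reflect] at hx⟩
  · rintro ⟨x, hx⟩; exact ⟨-x, by rwa [minimalPeriod_reflect, neg_neg]⟩

theorem continuous_reflect {f : ℝ → ℝ} (hf : Continuous f) : Continuous (reflect f) := by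
  unfold reflect; fun_prop

theorem periods_of_right_escape {f : ℝ → ℝ} (hf : Continuous f) {v q b z : ℝ}
    (hzb : z < b) (hz : f z = z) (hqv : q < v) (hbq : b ≤ q) (hv : f v = z)
    (hlt : ∀ t, t < v → b ≤ t → f t < z) (hq : v ≤ f (f q)) :
    HasMinPeriod f 2 ∧ HasMinPeriod f^[2] 3 := by
  have := periods_of_left_escape (continuous_reflect hf) (v := -v) (q := -q) (a := -b) (z := -z)
    (by linarith) (by simp [reflect, hz]) (by linarith) (by linarith) (by simp [reflect, hv])
    (fun t h1 h2 => neg_lt_neg (hlt (-t) (by linarith) (by linarith)))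
    (by simpa [reflect] using hq)
  rwa [reflect_iterate, hasMinPeriod_reflect, hasMinPeriod_reflect] at this

theorem exists_first_eq {f : ℝ → ℝ} (hf : Continuous f) {u b z : ℝ} (hbu : b ≤ u)
    (hu : z ≤ f u) (hb : f b < z) :
    ∃ v, v ≤ u ∧ b < v ∧ f v = z ∧ ∀ t, t < v → b ≤ t → f t < z := by
  obtain ⟨v, h1, h2, h3, h4⟩ := exists_last_eq (continuous_reflect hf) (u := -u) (a := -b)
    (z := -z) (by linarith) (by simpa [reflect] using hu) (by simpa [reflect] using hb)
  refine ⟨-v, by linarith, by linarith, by simpa [reflect] using h3, fun t ht hbt => ?_⟩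
  have := h4 (-t) (by linarith) (by linarith)
  simpa [reflect] using this

/-- The points `a < z < b` are such that `z` is fixed by `f`, the points `a` and `b` lie on a
common orbit of period `m`, are mapped past each other, and no point of the orbit lies
strictly between them. -/
structure OrbitGap (f : ℝ → ℝ) (m : ℕ) (a b z : ℝ) : Prop where
  per : minimalPeriod f a = m
  two_le : 2 ≤ m
  left : a < z
  right : z < b
  fix : f z = z
  map_left : b ≤ f a
  map_right : f b ≤ a
  mem : ∃ l, f^[l] a = b
  gap : ∀ i, f^[i] a ≤ a ∨ b ≤ f^[i] a

theorem iterate_mul_minimalPeriod {X : Type*} (f : X → X) (x : X) (l : ℕ) :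
    f^[l * minimalPeriod f x] x = x :=
  (isPeriodicPt_minimalPeriod f x).const_mul l

theorem iterate_eq_back {X : Type*} {f : X → X} {x y : X} (hpos : 0 < minimalPeriod f x) {l : ℕ}
    (h : f^[l] x = y) (i : ℕ) : f^[i + l * (minimalPeriod f x - 1)] y = f^[i] x := by
  rw [← h, ← iterate_add_apply]
  obtain ⟨r, hr⟩ : ∃ r, minimalPeriod f x = r + 1 := ⟨_, (Nat.sub_add_cancel hpos).symm⟩
  have : i + l * (minimalPeriod f x - 1) + l = i + l * minimalPeriod f x := by
    rw [hr, Nat.add_sub_cancel]; ring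
  rw [this, iterate_add_apply, iterate_mul_minimalPeriod]

namespace OrbitGap

variable {f : ℝ → ℝ} {m : ℕ} {a b z : ℝ}

theorem pos (h : OrbitGap f m a b z) : 0 < minimalPeriod f a := by
  have := h.two_le
  rw [h.per]; omega

theorem per_right (h : OrbitGap f m a b z) : minimalPeriod f b = m := by
  obtain ⟨l, hl⟩ := h.mem
  rw [← hl, minimalPeriod_apply_iterate (minimalPeriod_pos_iff_mem_periodicPts.1 h.pos), h.per]

theorem exists_iterate_right (h : OrbitGap f m a b z) (i : ℕ) : ∃ k, f^[k] b = f^[i] a := by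
  obtain ⟨l, hl⟩ := h.mem
  exact ⟨_, iterate_eq_back h.pos hl i⟩

theorem exists_iterate_left (h : OrbitGap f m a b z) (i : ℕ) : ∃ k, f^[k] a = f^[i] b := by
  obtain ⟨l, hl⟩ := h.mem
  exact ⟨i + l, by rw [iterate_add_apply, hl]⟩

protected theorem reflect (h : OrbitGap f m a b z) : OrbitGap (reflect f) m (-b) (-a) (-z) where
  per := by rw [minimalPeriod_reflect, neg_neg, h.per_right]
  two_le := h.two_le
  left := neg_lt_neg h.right
  right := neg_lt_neg h.left
  fix := by simp [_root_.reflect, h.fix]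
  map_left := by simpa [_root_.reflect] using h.map_right
  map_right := by simpa [_root_.reflect] using h.map_left
  mem := by
    obtain ⟨k, hk⟩ := h.exists_iterate_right 0
    exact ⟨k, by simpa [reflect_iterate, _root_.reflect] using hk⟩
  gap := by
    intro i
    obtain ⟨k, hk⟩ := h.exists_iterate_left i
    have := h.gap k
    rw [hk] at this
    simpa [reflect_iterate, _root_.reflect] using this.symm

end OrbitGap

theorem exists_orbitGap {f : ℝ → ℝ} (hf : Continuous f) {m : ℕ} (hm : 2 ≤ m)
    (hper : HasMinPeriod f m) : ∃ a b z, OrbitGap f m a b z := by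
  obtain ⟨x, hx⟩ := hper
  have hxp : x ∈ periodicPts f := minimalPeriod_pos_iff_mem_periodicPts.1 (by omega)
  let P : Finset ℝ := (Finset.range m).image fun i => f^[i] x
  have hP : ∀ p, p ∈ P ↔ ∃ i, f^[i] x = p := by
    intro p
    simp only [P, Finset.mem_image, Finset.mem_range]
    constructor
    · rintro ⟨i, -, h⟩; exact ⟨i, h⟩
    · rintro ⟨i, h⟩
      refine ⟨i % m, Nat.mod_lt _ (by omega), ?_⟩
      rw [← hx, iterate_mod_minimalPeriod_eq, h]
  have hfP : ∀ p ∈ P, f p ∈ P := by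
    intro p hp
    obtain ⟨i, rfl⟩ := (hP p).1 hp
    exact (hP _).2 ⟨i + 1, iterate_succ_apply' f i x⟩
  have hperP : ∀ p ∈ P, minimalPeriod f p = m := by
    intro p hp
    obtain ⟨i, rfl⟩ := (hP p).1 hp
    rw [minimalPeriod_apply_iterate hxp, hx]
  have hne : ∀ p ∈ P, f p ≠ p := by
    intro p hp h
    have := minimalPeriod_eq_one_iff_isFixedPt.2 h
    rw [hperP p hp] at this
    omega
  have hPne : P.Nonempty := ⟨x, (hP x).2 ⟨0, rfl⟩⟩
  obtain ⟨p₀, hp₀, hmin⟩ := P.exists_min_image id hPne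
  have hne1 : (P.filter fun p => p < f p).Nonempty :=
    ⟨p₀, Finset.mem_filter.2 ⟨hp₀, lt_of_le_of_ne (hmin _ (hfP _ hp₀)) (hne _ hp₀).symm⟩⟩
  obtain ⟨a, ha, hamax⟩ := Finset.exists_max_image _ id hne1
  obtain ⟨haP, haf⟩ := Finset.mem_filter.1 ha
  obtain ⟨b, hb, hbmin⟩ := Finset.exists_min_image (P.filter fun p => a < p) id
    ⟨f a, Finset.mem_filter.2 ⟨hfP a haP, haf⟩⟩
  obtain ⟨hbP, hab⟩ := Finset.mem_filter.1 hb
  have hgap : ∀ p ∈ P, p ≤ a ∨ b ≤ p := by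
    intro p hp
    rcases le_or_gt p a with h | h
    · exact Or.inl h
    · exact Or.inr (hbmin p (Finset.mem_filter.2 ⟨hp, h⟩))
  have hfa : b ≤ f a := (hgap _ (hfP a haP)).resolve_left (not_le.2 haf)
  have hfb : f b ≤ a := by
    refine (hgap _ (hfP b hbP)).resolve_right fun h => ?_
    have hlt : b < f b := lt_of_le_of_ne h (hne b hbP).symm
    exact absurd (hamax b (Finset.mem_filter.2 ⟨hbP, hlt⟩)) (not_le.2 hab)
  obtain ⟨z, hz, hzf⟩ := exists_mem_uIcc_isFixedPt (a := a) (b := b) hf.continuousOn haf.le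
    (hfb.trans hab.le)
  rw [Set.uIcc_of_le hab.le] at hz
  have haper := hperP a haP
  obtain ⟨i, rfl⟩ := (hP a).1 haP
  obtain ⟨j, rfl⟩ := (hP b).1 hbP
  refine ⟨_, _, z, haper, hm, ?_, ?_, hzf, hfa, hfb,
    ⟨_, iterate_eq_back (by omega) rfl j⟩, fun k => hgap _ ?_⟩
  · refine lt_of_le_of_ne hz.1 ?_
    rintro rfl
    exact hne _ haP hzf
  · refine lt_of_le_of_ne hz.2 ?_
    rintro rfl
    exact hne _ hbP hzf
  · exact (hP _).2 ⟨k + i, iterate_add_apply f k i x⟩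

theorem exists_fixed {f : ℝ → ℝ} (hf : Continuous f) {m : ℕ} (hm : 0 < m)
    (hper : HasMinPeriod f m) : HasMinPeriod f 1 := by
  rcases Nat.lt_or_ge m 2 with h | h
  · obtain rfl : m = 1 := by omega
    exact hper
  · obtain ⟨a, b, z, hg⟩ := exists_orbitGap hf h hper
    exact ⟨z, minimalPeriod_eq_one_iff_isFixedPt.2 hg.fix⟩

theorem even_of_alternating {s : ℕ → Prop} (h : ∀ i, s i ↔ ¬ s (i + 1)) {m : ℕ}
    (hm : s m ↔ s 0) : Even m := by
  by_contra hodd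
  rw [Nat.not_even_iff_odd] at hodd
  obtain ⟨r, rfl⟩ := hodd
  have heven : ∀ i, s (2 * i) ↔ s 0 := by
    intro i
    induction i with
    | zero => rfl
    | succ i ih =>
      have h1 := h (2 * i)
      have h2 := h (2 * i + 1)
      rw [← ih, show 2 * (i + 1) = 2 * i + 1 + 1 by ring]
      tauto
  have h1 := h (2 * r)
  rw [hm, heven] at h1
  exact iff_not_self h1

/-- If all points of a periodic orbit alternate between the left set `{q ≤ a | z < f on [q, a]}`
and the right set `{q ≥ b | f < z on [b, q]}`, the period is even and there is a point of
period two. -/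
theorem period_two_of_alternating {f : ℝ → ℝ} (hf : Continuous f) {a b z : ℝ} {c : ℝ} {m : ℕ}
    (haz : a < z) (hzb : z < b) (hm : 0 < m) (hc : minimalPeriod f c = m)
    (halt : ∀ i, ((f^[i] c ≤ a ∧ ∀ t, f^[i] c ≤ t → t ≤ a → z < f t) ∧ b ≤ f^[i + 1] c) ∨
      (b ≤ f^[i] c ∧ (f^[i + 1] c ≤ a ∧ ∀ t, f^[i + 1] c ≤ t → t ≤ a → z < f t))) :
    HasMinPeriod f 2 ∧ Even m := by
  have hside : ∀ i, (f^[i] c ≤ a ↔ ¬ f^[i + 1] c ≤ a) := by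
    intro i
    rcases halt i with h | h
    · have := h.1.1
      have := h.2
      constructor
      · intro _; linarith
      · intro _; assumption
    · have := h.1
      have := h.2.1
      constructor
      · intro _; linarith
      · intro h'; exact absurd this h'
  constructor
  · obtain ⟨e, he⟩ : ∃ e, f^[e] c ≤ a := by
      by_cases h : f^[0] c ≤ a
      · exact ⟨0, h⟩
      · exact ⟨1, by by_contra h'; exact h ((hside 0).2 h')⟩
    have hleft : ∀ i, f^[e + 2 * i] c ≤ a := by
      intro i
      induction i with
      | zero => exact he
      | succ i ih =>
        have h1 := (hside _).1 ih
        have h2 := hside (e + 2 * i + 1)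
        by_contra h
        exact h1 (h2.2 h)
    have hgt : ∀ i, ∀ t, f^[e + 2 * i] c ≤ t → t ≤ a → z < f t := by
      intro i
      rcases halt (e + 2 * i) with h | h
      · exact h.1.2
      · have := hleft i
        linarith [h.1]
    have hstep : ∀ i, f^[e + 2 * (i + 1)] c = f (f (f^[e + 2 * i] c)) := by
      intro i
      rw [show e + 2 * (i + 1) = e + 2 * i + 1 + 1 by ring, iterate_succ_apply',
        iterate_succ_apply']
    have hperiod : f^[e + 2 * m] c = f^[e + 2 * 0] c := by
      rw [iterate_add_apply, ← hc, iterate_mul_minimalPeriod]; rfl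
    obtain ⟨i, hi⟩ : ∃ i, f^[e + 2 * i] c ≤ f (f (f^[e + 2 * i] c)) := by
      by_contra! h
      have hanti : StrictAnti fun i => f^[e + 2 * i] c :=
        strictAnti_nat_of_succ_lt fun i => by rw [hstep]; exact h i
      exact absurd (hanti hm) (by simp only [hperiod]; exact lt_irrefl _)
    obtain ⟨k, hk⟩ : ∃ k, f (f (f^[e + 2 * k] c)) ≤ f^[e + 2 * k] c := by
      by_contra! h
      have hmono : StrictMono fun i => f^[e + 2 * i] c :=
        strictMono_nat_of_lt_succ fun i => by rw [hstep]; exact h i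
      exact absurd (hmono hm) (by simp only [hperiod]; exact lt_irrefl _)
    obtain ⟨y, hy, hfix⟩ := exists_mem_uIcc_isFixedPt (f := f^[2]) (hf.iterate 2).continuousOn hi hk
    have hya : y ≤ a := hy.2.trans (sup_le (hleft i) (hleft k))
    refine hasMinPeriod_two_of_fixed (y := y) hfix ?_
    have : z < f y := by
      rcases inf_le_iff.1 hy.1 with h | h
      · exact hgt i y h hya
      · exact hgt k y h hya
    intro h
    linarith
  · refine even_of_alternating hside ?_
    rw [← hc, iterate_minimalPeriod, iterate_zero, id]

theorem OrbitGap.escape_or_even {f : ℝ → ℝ} (hf : Continuous f) {m : ℕ} {a b z : ℝ}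
    (h : OrbitGap f m a b z) :
    (HasMinPeriod f 2 ∧ HasMinPeriod f^[2] 3) ∨ (HasMinPeriod f 2 ∧ Even m) := by
  by_contra hcon
  rw [not_or] at hcon
  obtain ⟨hesc, halt⟩ := hcon
  have haz := h.left
  have hzb := h.right
  have hma := h.map_left
  have hmb := h.map_right
  let L : ℝ → Prop := fun q => q ≤ a ∧ ∀ t, q ≤ t → t ≤ a → z < f t
  let R : ℝ → Prop := fun q => b ≤ q ∧ ∀ t, b ≤ t → t ≤ q → f t < z
  have hLa : L a := ⟨le_rfl, fun t h1 h2 => by rw [le_antisymm h2 h1]; linarith⟩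
  have hRb : R b := ⟨le_rfl, fun t h1 h2 => by rw [le_antisymm h2 h1]; linarith⟩
  have notL : ∀ q ≤ a, ¬ L q → ∃ v, q ≤ v ∧ v < a ∧ f v = z ∧ ∀ t, v < t → t ≤ a → z < f t := by
    intro q hq hL
    have : ∃ t, q ≤ t ∧ t ≤ a ∧ f t ≤ z := by
      by_contra! h'; exact hL ⟨hq, h'⟩
    obtain ⟨u, h1, h2, h3⟩ := this
    obtain ⟨v, k1, k2, k3, k4⟩ := exists_last_eq hf h2 h3 (by linarith)
    exact ⟨v, h1.trans k1, k2, k3, k4⟩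
  have notR : ∀ q, b ≤ q → ¬ R q →
      ∃ v, v ≤ q ∧ b < v ∧ f v = z ∧ ∀ t, t < v → b ≤ t → f t < z := by
    intro q hq hR
    have : ∃ t, b ≤ t ∧ t ≤ q ∧ z ≤ f t := by
      by_contra! h'; exact hR ⟨hq, h'⟩
    obtain ⟨u, h1, h2, h3⟩ := this
    obtain ⟨v, k1, k2, k3, k4⟩ := exists_first_eq hf h1 h3 (by linarith)
    exact ⟨v, k1.trans h2, k2, k3, k4⟩
  have stepL : ∀ q, L q → f (f q) ≤ a → L (f (f q)) := by
    intro q hq hle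
    by_contra hL
    obtain ⟨v, h1, h2, h3, h4⟩ := notL _ hle hL
    have hvq : v < q := by
      by_contra! hqv
      have := hq.2 v hqv h2.le
      linarith
    exact hesc (periods_of_left_escape hf haz h.fix hvq hq.1 h3 h4 h1)
  have stepR : ∀ q, R q → b ≤ f (f q) → R (f (f q)) := by
    intro q hq hle
    by_contra hR
    obtain ⟨v, h1, h2, h3, h4⟩ := notR _ hle hR
    have hvq : q < v := by
      by_contra! hqv
      have := hq.2 v h2.le hqv
      linarith
    exact hesc (periods_of_right_escape hf hzb h.fix hvq hq.1 h3 h4 h1)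
  have hstart : R (f a) ∨ L (f b) := by
    by_contra! hcon
    obtain ⟨v, h1, h2, h3, h4⟩ := notL _ hmb hcon.2
    obtain ⟨t, ht, hft⟩ := intermediate_value_Icc h2.le hf.continuousOn
      (⟨by linarith, hma⟩ : b ∈ Set.Icc (f v) (f a))
    have hvt : v < t := by
      refine lt_of_le_of_ne ht.1 ?_
      rintro rfl
      linarith
    exact hesc (periods_of_left_escape hf haz h.fix hvt ht.2 h3 h4 (by rw [hft]; exact h1))
  have key : ∀ c, (∀ i, f^[i] c ≤ a ∨ b ≤ f^[i] c) →
      ((L c ∧ R (f c)) ∨ (R c ∧ L (f c))) → minimalPeriod f c = m → False := by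
    intro c hgap h0 hper
    have hall : ∀ i, (L (f^[i] c) ∧ R (f^[i + 1] c)) ∨ (R (f^[i] c) ∧ L (f^[i + 1] c)) := by
      intro i
      induction i with
      | zero => exact h0
      | succ i ih =>
        have e1 : f^[i + 1] c = f (f^[i] c) := iterate_succ_apply' f i c
        have e2 : f^[i + 1 + 1] c = f (f (f^[i] c)) := by rw [iterate_succ_apply', e1]
        have hg := hgap (i + 1 + 1)
        rw [e2] at hg ⊢
        rcases ih with ⟨hl, hr⟩ | ⟨hr, hl⟩
        · refine Or.inr ⟨hr, stepL _ hl (hg.resolve_right fun hb => ?_)⟩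
          have := hr.2 _ hr.1 le_rfl
          rw [e1] at this
          linarith
        · refine Or.inl ⟨hl, stepR _ hr (hg.resolve_left fun hb => ?_)⟩
          have := hl.2 _ le_rfl hl.1
          rw [e1] at this
          linarith
    refine halt (period_two_of_alternating hf haz hzb (by have := h.two_le; omega) hper ?_)
    intro i
    rcases hall i with ⟨hl, hr⟩ | ⟨hr, hl⟩
    · exact Or.inl ⟨hl, hr.1⟩
    · exact Or.inr ⟨hr.1, hl⟩
  rcases hstart with hR | hL
  · exact key a h.gap (Or.inl ⟨hLa, hR⟩) h.per
  · refine key b (fun i => ?_) (Or.inr ⟨hRb, hL⟩) h.per_right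
    obtain ⟨k, hk⟩ := h.exists_iterate_left i
    rw [← hk]
    exact h.gap k

theorem hasMinPeriod_two {f : ℝ → ℝ} (hf : Continuous f) {m : ℕ} (hm : 2 ≤ m)
    (hper : HasMinPeriod f m) : HasMinPeriod f 2 := by
  obtain ⟨a, b, z, h⟩ := exists_orbitGap hf hm hper
  rcases h.escape_or_even hf with h | h
  · exact h.1
  · exact h.1

theorem hasMinPeriod_three_iterate_two {f : ℝ → ℝ} (hf : Continuous f) {m : ℕ} (hm : 2 ≤ m)
    (hodd : Odd m) (hper : HasMinPeriod f m) : HasMinPeriod f^[2] 3 := by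
  obtain ⟨a, b, z, h⟩ := exists_orbitGap hf hm hper
  rcases h.escape_or_even hf with h | h
  · exact h.2
  · exact absurd h.2 (Nat.not_even_iff_odd.2 hodd)

theorem OrbitGap.exists_periodic_of_left {f : ℝ → ℝ} (hf : Continuous f) {m : ℕ} {a b z : ℝ}
    (h : OrbitGap f m a b z) (hm : 3 ≤ m) {j : ℕ} (hj : f^[j] a < z) (hj' : f^[j + 1] a < z)
    {n : ℕ} (hn : m < n) :
    ∃ y, f^[n] y = y ∧ ∀ e, m ≤ e + 1 → e < n → f^[e] y ≠ y := by
  obtain ⟨i, him, hi⟩ : ∃ i < m, f^[i] a = f^[j] a :=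
    ⟨j % m, Nat.mod_lt _ (by omega), by rw [← h.per, iterate_mod_minimalPeriod_eq]⟩
  rw [← hi] at hj
  rw [iterate_succ_apply', ← hi, ← iterate_succ_apply' f] at hj'
  have haz := h.left
  have hzb := h.right
  have hma := h.map_left
  have hmb := h.map_right
  have hc : f^[i] a ≤ a := (h.gap i).resolve_right fun hb => by linarith
  have hfc : f (f^[i] a) ≤ a := by
    rw [← iterate_succ_apply' f]
    exact (h.gap (i + 1)).resolve_right fun hb => by linarith
  have hab : a ≤ b := by linarith
  have hK : Set.SurjOn f (Set.Icc a b) (Set.Icc a b) :=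
    surjOn_Icc_of_le_of_ge hf ⟨hab, le_rfl⟩ ⟨le_rfl, hab⟩ hmb hma
  have hKD : Set.SurjOn f^[i] (Set.Icc a b) (Set.Icc (f^[i] a) a) :=
    surjOn_Icc_of_le_of_ge (hf.iterate i) (p := a) (q := z) ⟨le_rfl, hab⟩ ⟨haz.le, hzb.le⟩ le_rfl
      (by rw [iterate_fixed h.fix]; exact haz.le)
  have hDK : Set.SurjOn f (Set.Icc (f^[i] a) a) (Set.Icc a b) :=
    surjOn_Icc_of_le_of_ge hf ⟨le_rfl, hc⟩ ⟨hc, le_rfl⟩ hfc hma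
  obtain ⟨y, hy1, hy2, hy3⟩ := exists_periodic_of_loop hf hab hc hK hKD hDK (n - i - 1)
  have e1 : n - i - 1 + i = n - 1 := by omega
  have e2 : n - i - 1 + i + 1 = n - 1 + 1 := by omega
  have e3 : n = n - 1 + 1 := by omega
  rw [e1] at hy2
  rw [e2] at hy3
  refine ⟨y, by rw [e3]; exact hy3, fun e he hen hfix => ?_⟩
  have h1 : f^[n - 1] y = f^[n - 1 - e] y := by
    conv_lhs => rw [show n - 1 = n - 1 - e + e by omega, iterate_add_apply, hfix]
  have h2 := hy1 (n - 1 - e) (by omega)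
  rw [← h1] at h2
  have h3 : f^[n - 1] y = a := le_antisymm hy2.2 h2.1
  have h4 : f a = y := by rw [← h3, ← iterate_succ_apply' f]; exact hy3
  have h5 : y = b := le_antisymm (hy1 0 (by omega)).2 (h4 ▸ hma)
  have h6 : f b = a := by
    refine le_antisymm hmb ?_
    rw [← h5]
    exact (hy1 1 (by omega)).1
  have h7 : f^[2] a = a := by
    change f (f a) = a
    rw [h4, h5, h6]
  have := IsPeriodicPt.minimalPeriod_le (by norm_num) (show IsPeriodicPt f 2 a from h7)
  rw [h.per] at this
  omega

/-- A map with a point of odd period `m ≥ 3` has, for every `n > m`, a point of period dividing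
`n` that does not return to itself at any of the times `m - 1, …, n - 1`. -/
theorem exists_periodic_of_odd {f : ℝ → ℝ} (hf : Continuous f) {m : ℕ} (hm : 3 ≤ m)
    (hodd : Odd m) (hper : HasMinPeriod f m) {n : ℕ} (hn : m < n) :
    ∃ y, f^[n] y = y ∧ ∀ e, m ≤ e + 1 → e < n → f^[e] y ≠ y := by
  obtain ⟨a, b, z, h⟩ := exists_orbitGap hf (by omega) hper
  by_cases hl : ∃ j, f^[j] a < z ∧ f^[j + 1] a < z
  · obtain ⟨j, h1, h2⟩ := hl
    exact h.exists_periodic_of_left hf hm h1 h2 hn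
  by_cases hr : ∃ j, z < f^[j] a ∧ z < f^[j + 1] a
  · obtain ⟨j, h1, h2⟩ := hr
    obtain ⟨k, hk⟩ := h.exists_iterate_right j
    have hk' : f^[k + 1] b = f^[j + 1] a := by rw [iterate_succ_apply', hk, iterate_succ_apply']
    obtain ⟨y, hy, hye⟩ := h.reflect.exists_periodic_of_left (continuous_reflect hf) hm (j := k)
      (by rw [reflect_iterate]; simpa [reflect, hk] using h1)
      (by rw [reflect_iterate]; simpa only [reflect, neg_neg, hk', neg_lt_neg_iff] using h2) hn
    refine ⟨-y, ?_, fun e h1 h2 h3 => hye e h1 h2 ?_⟩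
    · rw [reflect_iterate] at hy
      exact neg_eq_iff_eq_neg.1 hy
    · rw [reflect_iterate, reflect, h3, neg_neg]
  · exfalso
    have hne : ∀ i, f^[i] a < z ∨ z < f^[i] a := by
      intro i
      have := h.left
      have := h.right
      rcases h.gap i with h | h
      · left; linarith
      · right; linarith
    refine absurd (even_of_alternating (s := fun i => f^[i] a < z) (m := m) (fun i => ?_) ?_)
      (Nat.not_even_iff_odd.2 hodd)
    · constructor
      · intro h1 h2; exact hl ⟨i, h1, h2⟩
      · intro h1
        refine (hne i).resolve_right fun h2 => hr ⟨i, h2, (hne (i + 1)).resolve_left h1⟩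
    · simp only [← h.per, iterate_minimalPeriod, iterate_zero, id]

theorem hasMinPeriod_two_mul_of_odd {f : ℝ → ℝ} (hf : Continuous f) {m : ℕ} (hm : 3 ≤ m)
    (hodd : Odd m) (hper : HasMinPeriod f m) : HasMinPeriod f (2 * m) := by
  obtain ⟨y, hy, hye⟩ := exists_periodic_of_odd hf hm hodd hper (n := 2 * m) (by omega)
  refine ⟨y, ?_⟩
  have hyp : IsPeriodicPt f (2 * m) y := hy
  obtain ⟨c, hc⟩ := hyp.minimalPeriod_dvd
  have hpos := hyp.minimalPeriod_pos (by omega)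
  set d := minimalPeriod f y with hd
  by_contra hne
  have hc2 : 2 ≤ c := by
    by_contra! h
    interval_cases c <;> omega
  have hdm : d ≤ m := by nlinarith
  refine hye (2 * m - d) (by omega) (by omega) ?_
  have : 2 * m - d = (c - 1) * d := by
    rw [Nat.sub_mul, hc, one_mul, mul_comm]
  rw [this]
  exact iterate_mul_minimalPeriod f y _

theorem hasMinPeriod_odd_of_odd {f : ℝ → ℝ} (hf : Continuous f) {m n : ℕ} (hm : 3 ≤ m)
    (hodd : Odd m) (hper : HasMinPeriod f m) (hmn : m ≤ n) (hn : Odd n) : HasMinPeriod f n := by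
  classical
  have hex : ∃ k, 3 ≤ k ∧ Odd k ∧ HasMinPeriod f k := ⟨m, hm, hodd, hper⟩
  obtain ⟨h3, hko, hkp⟩ := Nat.find_spec hex
  have hkm : Nat.find hex ≤ m := Nat.find_min' hex ⟨hm, hodd, hper⟩
  have hmin : ∀ k, 3 ≤ k → Odd k → HasMinPeriod f k → Nat.find hex ≤ k :=
    fun k h1 h2 h4 => Nat.find_min' hex ⟨h1, h2, h4⟩
  generalize Nat.find hex = k at *
  rcases (hkm.trans hmn).eq_or_lt with rfl | hkn
  · exact hkp
  obtain ⟨y, hy, hye⟩ := exists_periodic_of_odd hf h3 hko hkp hkn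
  refine ⟨y, ?_⟩
  have hyp : IsPeriodicPt f n y := hy
  have hdvd := hyp.minimalPeriod_dvd
  have hdodd : Odd (minimalPeriod f y) := hn.of_dvd_nat hdvd
  have hle := Nat.le_of_dvd (by omega) hdvd
  rcases hle.eq_or_lt with h | hlt
  · exact h
  exfalso
  by_cases h1 : minimalPeriod f y = 1
  · exact hye (k - 1) (by omega) (by omega)
      (iterate_fixed (minimalPeriod_eq_one_iff_isFixedPt.1 h1) _)
  · have hd3 : 3 ≤ minimalPeriod f y := by
      obtain ⟨r, hr⟩ := hdodd
      omega
    have := hmin _ hd3 hdodd ⟨y, rfl⟩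
    exact hye _ (by omega) hlt iterate_minimalPeriod

theorem HasMinPeriod.iterate {X : Type*} {f : X → X} {m : ℕ} (h : HasMinPeriod f m) {n : ℕ}
    (hn : n ≠ 0) : HasMinPeriod f^[n] (m / Nat.gcd m n) := by
  obtain ⟨x, rfl⟩ := h
  exact ⟨x, minimalPeriod_iterate_eq_div_gcd hn⟩

/-- A point of even period `n` for `f^[2 ^ l]` has period `2 ^ l * n` for `f`. -/
theorem HasMinPeriod.of_iterate_two_pow {X : Type*} {f : X → X} {n l : ℕ} (hn : Even n)
    (h : HasMinPeriod f^[2 ^ l] n) : HasMinPeriod f (2 ^ l * n) := by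
  obtain ⟨x, hx⟩ := h
  refine ⟨x, ?_⟩
  rw [minimalPeriod_iterate_eq_div_gcd (by positivity)] at hx
  obtain ⟨i, hi, hgcd⟩ := (Nat.dvd_prime_pow Nat.prime_two).1
    (Nat.gcd_dvd_right (minimalPeriod f x) (2 ^ l))
  have hM : minimalPeriod f x = 2 ^ i * n := by
    rw [← hx, hgcd, Nat.mul_div_cancel']
    rw [← hgcd]; exact Nat.gcd_dvd_left _ _
  rcases hi.eq_or_lt with rfl | hlt
  · exact hM
  exfalso
  have h1 : 2 ^ (i + 1) ∣ Nat.gcd (minimalPeriod f x) (2 ^ l) := by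
    refine Nat.dvd_gcd ?_ (pow_dvd_pow 2 hlt)
    rw [hM, pow_succ]
    exact mul_dvd_mul_left _ hn.two_dvd
  rw [hgcd] at h1
  have := (Nat.pow_dvd_pow_iff_le_right (by norm_num : 1 < 2)).1 h1
  omega

theorem hasMinPeriod_two_mul_of_iterate_two {f : ℝ → ℝ} (hf : Continuous f) {n : ℕ} (hn : 3 ≤ n)
    (hodd : Odd n) (h : HasMinPeriod f^[2] n) : HasMinPeriod f (2 * n) := by
  obtain ⟨x, hx⟩ := h
  rw [minimalPeriod_iterate_eq_div_gcd (by norm_num)] at hx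
  rcases (Nat.dvd_prime Nat.prime_two).1 (Nat.gcd_dvd_right (minimalPeriod f x) 2) with h | h
  · rw [h, Nat.div_one] at hx
    exact hasMinPeriod_two_mul_of_odd hf hn hodd ⟨x, hx⟩
  · refine ⟨x, ?_⟩
    rw [← hx, h, Nat.mul_div_cancel']
    rw [← h]; exact Nat.gcd_dvd_left _ _

theorem hasMinPeriod_two_pow {f : ℝ → ℝ} (hf : Continuous f) {m : ℕ} (hm : 0 < m)
    (hper : HasMinPeriod f m) {c : ℕ} (hc : ∀ i, c = i + 1 → ¬ m ∣ 2 ^ i) :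
    HasMinPeriod f (2 ^ c) := by
  cases c with
  | zero => exact exists_fixed hf hm hper
  | succ i =>
    have hi := hc i rfl
    have hg := hper.iterate (n := 2 ^ i) (by positivity)
    have hd := Nat.gcd_dvd_left m (2 ^ i)
    have hpos : 0 < m / Nat.gcd m (2 ^ i) :=
      Nat.div_pos (Nat.le_of_dvd hm hd) (Nat.gcd_pos_of_pos_left _ hm)
    have hne : m / Nat.gcd m (2 ^ i) ≠ 1 := by
      intro h
      apply hi
      have := Nat.div_mul_cancel hd
      rw [h, one_mul] at this
      exact this ▸ Nat.gcd_dvd_right m (2 ^ i)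
    rw [pow_succ]
    exact (hasMinPeriod_two (hf.iterate _) (by omega) hg).of_iterate_two_pow even_two

theorem two_pow_mul_div_gcd {a l m : ℕ} (hodd : Odd m) (hal : a ≤ l) :
    2 ^ a * m / Nat.gcd (2 ^ a * m) (2 ^ l) = m := by
  obtain ⟨r, rfl⟩ := Nat.exists_eq_add_of_le hal
  have hcop : Nat.Coprime m (2 ^ r) := (Nat.Coprime.pow_left r hodd.coprime_two_left).symm
  rw [pow_add, Nat.gcd_mul_left, hcop, mul_one, Nat.mul_div_cancel_left _ (by positivity)]

/-- Sharkovsky's theorem for continuous self-maps of the real line. -/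
theorem sharkovsky_real {f : ℝ → ℝ} (hf : Continuous f) {m k : ℕ} (h : SharkGt m k)
    (hper : HasMinPeriod f m) : HasMinPeriod f k := by
  obtain ⟨a, m', c, k', hm', hk', rfl, rfl, hcase⟩ := h
  have hmpos : 0 < m' := hm'.pos
  have hm3 : 1 < m' → 3 ≤ m' := fun h => by obtain ⟨r, hr⟩ := hm'; omega
  rcases hcase with ⟨hm1, hk1, hac⟩ | ⟨hm1, rfl⟩ | ⟨rfl, rfl, hca⟩
  · have hk3 : 3 ≤ k' := by obtain ⟨r, hr⟩ := hk'; omega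
    have hiter : ∀ l, a ≤ l → HasMinPeriod f^[2 ^ l] m' := by
      intro l hl
      have := hper.iterate (n := 2 ^ l) (by positivity)
      rwa [two_pow_mul_div_gcd hm' hl] at this
    have hlift : ∀ l, HasMinPeriod f^[2 ^ (l + 1)] k' → HasMinPeriod f (2 ^ (l + 1) * k') := by
      intro l hl
      rw [pow_succ, iterate_mul] at hl
      rw [pow_succ, mul_assoc]
      exact (hasMinPeriod_two_mul_of_iterate_two (hf.iterate _) hk3 hk' hl).of_iterate_two_pow
        (even_two_mul _)
    rcases hac with hac | ⟨rfl, hlt⟩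
    · obtain ⟨l, rfl⟩ : ∃ l, c = l + 1 := ⟨c - 1, by omega⟩
      apply hlift
      have h3 := hasMinPeriod_three_iterate_two (hf.iterate _) (by omega) hm'
        (hiter l (by omega))
      rw [← iterate_mul, ← pow_succ] at h3
      exact hasMinPeriod_odd_of_odd (hf.iterate _) le_rfl (by decide) h3 hk3 hk'
    · have h1 := hasMinPeriod_odd_of_odd (hf.iterate _) (hm3 hm1) hm' (hiter a le_rfl) hlt.le hk'
      cases a with
      | zero => simpa using h1
      | succ l => exact hlift l h1
  · rw [mul_one]
    refine hasMinPeriod_two_pow hf (by positivity) hper fun i _ hdvd => ?_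
    have h1 : m' ∣ 2 ^ i := (dvd_mul_left _ _).trans hdvd
    have h2 : Nat.Coprime m' (2 ^ i) := (Nat.Coprime.pow_left i hm'.coprime_two_left).symm
    have := Nat.Coprime.eq_one_of_dvd h2 h1
    omega
  · rw [mul_one] at hper ⊢
    refine hasMinPeriod_two_pow hf (by positivity) hper fun i hi hdvd => ?_
    have := (Nat.pow_dvd_pow_iff_le_right (by norm_num : 1 < 2)).1 hdvd
    omega

theorem minimalPeriod_of_semiconj_injective {X Y : Type*} {fa : X → X} {fb : Y → Y} {g : X → Y}
    (hg : Injective g) (h : Semiconj g fa fb) (x : X) :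
    minimalPeriod fb (g x) = minimalPeriod fa x := by
  rw [minimalPeriod_eq_minimalPeriod_iff]
  intro n
  simp only [IsPeriodicPt, IsFixedPt, ← (h.iterate_right n).eq x]
  exact hg.eq_iff

theorem SharkGt.pos {m k : ℕ} (h : SharkGt m k) : 0 < k := by
  obtain ⟨a, m', c, k', -, hk', -, rfl, -⟩ := h
  have := hk'.pos
  positivity

/-- The extension of a self-map of `[0,1]` to the line, constant on both sides. -/
noncomputable def extendToReal (f : I → I) : ℝ → ℝ :=
  fun x => f (Set.projIcc 0 1 zero_le_one x)

theorem semiconj_extendToReal (f : I → I) :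
    Semiconj ((↑) : I → ℝ) f (extendToReal f) := by
  intro x
  simp [extendToReal]

theorem hasMinPeriod_extendToReal {f : I → I} {n : ℕ} (hn : 0 < n) :
    HasMinPeriod (extendToReal f) n ↔ HasMinPeriod f n := by
  constructor
  · rintro ⟨x, hx⟩
    have hfix : (extendToReal f)^[n] x = x := by rw [← hx]; exact iterate_minimalPeriod
    obtain ⟨n, rfl⟩ : ∃ r, n = r + 1 := ⟨n - 1, by omega⟩
    rw [iterate_succ_apply'] at hfix
    obtain ⟨y, rfl⟩ : ∃ y : I, (y : ℝ) = x := ⟨_, hfix⟩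
    exact ⟨y, by
      rwa [minimalPeriod_of_semiconj_injective Subtype.val_injective (semiconj_extendToReal f)]
        at hx⟩
  · rintro ⟨x, hx⟩
    exact ⟨x, by
      rwa [minimalPeriod_of_semiconj_injective Subtype.val_injective (semiconj_extendToReal f)]⟩

/-- Sharkovsky's theorem for continuous self-maps of the unit interval. -/
theorem sharkovsky_unitInterval {f : I → I} (hf : Continuous f) {m k : ℕ} (hm : 0 < m)
    (h : SharkGt m k) (hper : HasMinPeriod f m) : HasMinPeriod f k := by
  rw [← hasMinPeriod_extendToReal h.pos]
  refine sharkovsky_real ?_ h ((hasMinPeriod_extendToReal hm).2 hper)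
  unfold extendToReal
  exact continuous_subtype_val.comp (hf.comp continuous_projIcc)

theorem exists_fixed_unitInterval {f : I → I} (hf : Continuous f) : ∃ x, f x = x := by
  obtain ⟨x, -, hx⟩ := exists_mem_Icc_isFixedPt_of_mapsTo (a := (0 : I)) (b := 1)
    hf.continuousOn zero_le_one fun x _ => ⟨unitInterval.nonneg', unitInterval.le_one'⟩
  exact ⟨x, hx⟩

theorem two_pow_mul_odd_inj {a b m n : ℕ} (hm : Odd m) (hn : Odd n)
    (h : 2 ^ a * m = 2 ^ b * n) : a = b ∧ m = n := by
  have aux : ∀ {a b m n : ℕ}, Odd n → 2 ^ a * m = 2 ^ b * n → a ≤ b := by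
    intro a b m n hn h
    have h1 : 2 ^ a ∣ 2 ^ b * n := h ▸ dvd_mul_right _ _
    have h2 : Nat.Coprime (2 ^ a) n := Nat.Coprime.pow_left a hn.coprime_two_left
    exact (Nat.pow_dvd_pow_iff_le_right (by norm_num : 1 < 2)).1 (h2.dvd_of_dvd_mul_right h1)
  obtain rfl : a = b := le_antisymm (aux hn h) (aux hm h.symm)
  exact ⟨rfl, Nat.eq_of_mul_eq_mul_left (by positivity) h⟩

/-- A number below a product `p * q` in the Sharkovsky ordering is `p`, or below `p`,
or `p` times a number below `q`. -/
theorem SharkGt.of_mul {p q k : ℕ} (hp : 0 < p) (hq : 0 < q) (h : SharkGt (p * q) k) :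
    k = p ∨ SharkGt p k ∨ ∃ r, k = p * r ∧ SharkGt q r := by
  obtain ⟨a, m', c, k', hm', hk', hpq, rfl, hcase⟩ := h
  obtain ⟨b, p', hp', rfl⟩ := Nat.exists_eq_two_pow_mul_odd hp.ne'
  obtain ⟨d, q', hq', rfl⟩ := Nat.exists_eq_two_pow_mul_odd hq.ne'
  obtain ⟨rfl, rfl⟩ := two_pow_mul_odd_inj (hp'.mul hq') hm'
    (show 2 ^ (b + d) * (p' * q') = 2 ^ a * m' by rw [← hpq, pow_add]; ring)
  have hp0 := hp'.pos
  have hq0 := hq'.pos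
  rcases Nat.lt_or_ge 1 p' with hp1 | hp1
  · right; left
    have hle : p' ≤ p' * q' := Nat.le_mul_of_pos_right _ hq0
    refine ⟨b, p', c, k', hp', hk', rfl, rfl, ?_⟩
    omega
  · obtain rfl : p' = 1 := by omega
    rw [one_mul] at hcase
    rcases Nat.lt_trichotomy b c with hbc | rfl | hbc
    · right; right
      obtain ⟨e, rfl⟩ := Nat.exists_eq_add_of_le hbc.le
      refine ⟨2 ^ e * k', by rw [pow_add]; ring, d, q', e, k', hq', hk', rfl, rfl, ?_⟩
      omega
    · by_cases hk1 : k' = 1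
      · left; rw [hk1]
      · right; right
        have := hk'.pos
        refine ⟨2 ^ 0 * k', by ring, d, q', 0, k', hq', hk', rfl, rfl, ?_⟩
        omega
    · right; left
      refine ⟨b, 1, c, k', odd_one, hk', rfl, rfl, ?_⟩
      omega

section Triangular

variable {f : I → I} {g : I × I → I}

theorem continuous_triMap (hf : Continuous f) (hg : Continuous g) : Continuous (triMap f g) :=
  (hf.comp continuous_fst).prodMk hg

theorem triMap_iterate_fst (n : ℕ) (z : I × I) : ((triMap f g)^[n] z).1 = f^[n] z.1 :=
  Semiconj.iterate_right (f := Prod.fst) (ga := triMap f g) (gb := f) (fun _ => rfl) n z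

/-- The return map of `triMap f g` to the fibre over a point `x` with `f^[n] x = x`. -/
def fibreMap (f : I → I) (g : I × I → I) (n : ℕ) (x : I) : I → I :=
  fun y => ((triMap f g)^[n] (x, y)).2

theorem continuous_fibreMap (hf : Continuous f) (hg : Continuous g) (n : ℕ) (x : I) :
    Continuous (fibreMap f g n x) :=
  continuous_snd.comp (((continuous_triMap hf hg).iterate n).comp (by fun_prop))

theorem semiconj_fibreMap {n : ℕ} {x : I} (hx : f^[n] x = x) :
    Semiconj (Prod.mk x) (fibreMap f g n x) (triMap f g)^[n] := by
  intro y
  refine Prod.ext ?_ rfl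
  rw [triMap_iterate_fst, hx]

theorem minimalPeriod_triMap {x : I} (y : I) :
    minimalPeriod (triMap f g) (x, y) =
      minimalPeriod f x * minimalPeriod (fibreMap f g (minimalPeriod f x) x) y := by
  set p := minimalPeriod f x with hp
  have hx : f^[p] x = x := iterate_minimalPeriod
  have hdvd : ∀ n, f^[n] x = x ↔ p ∣ n := fun n => isPeriodicPt_iff_minimalPeriod_dvd
  have hfib : minimalPeriod (triMap f g)^[p] (x, y) = minimalPeriod (fibreMap f g p x) y :=
    minimalPeriod_of_semiconj_injective (Prod.mk_right_injective x) (semiconj_fibreMap hx) y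
  rw [← hfib]
  apply Nat.dvd_antisymm
  · apply IsPeriodicPt.minimalPeriod_dvd
    have := isPeriodicPt_minimalPeriod (triMap f g)^[p] (x, y)
    rwa [IsPeriodicPt, ← iterate_mul] at this
  · have hfst : f^[minimalPeriod (triMap f g) (x, y)] x = x := by
      have := congrArg Prod.fst (iterate_minimalPeriod (f := triMap f g) (x := (x, y)))
      rwa [triMap_iterate_fst] at this
    obtain ⟨j, hj⟩ := (hdvd _).1 hfst
    rw [hj]
    apply mul_dvd_mul_left
    apply IsPeriodicPt.minimalPeriod_dvd
    rw [IsPeriodicPt, ← iterate_mul, ← hj]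
    exact iterate_minimalPeriod

theorem HasMinPeriod.triMap (hf : Continuous f) (hg : Continuous g) {n : ℕ}
    (h : HasMinPeriod f n) : HasMinPeriod (triMap f g) n := by
  obtain ⟨x, rfl⟩ := h
  obtain ⟨y, hy⟩ := exists_fixed_unitInterval (continuous_fibreMap hf hg (minimalPeriod f x) x)
  refine ⟨(x, y), ?_⟩
  rw [minimalPeriod_triMap, minimalPeriod_eq_one_iff_isFixedPt.2 hy, mul_one]

end Triangular

theorem minPeriod_iff {X : Type*} {F : X → X} {z : X} {n : ℕ} :
    MinPeriod F z n ↔ 0 < n ∧ minimalPeriod F z = n := by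
  constructor
  · rintro ⟨hn, hfix, hmin⟩
    have hz : IsPeriodicPt F n z := hfix
    refine ⟨hn, (hz.minimalPeriod_le hn).antisymm ?_⟩
    by_contra! h
    exact hmin _ (hz.minimalPeriod_pos hn) h iterate_minimalPeriod
  · rintro ⟨hn, rfl⟩
    exact ⟨hn, iterate_minimalPeriod,
      fun k hk hlt => not_isPeriodicPt_of_pos_of_lt_minimalPeriod hk.ne' hlt⟩

/-- Kloeden: Sharkovsky's theorem holds for continuous triangular maps. If `T` has a
periodic point of minimal period `m` and `m >_s k` in the Sharkovsky ordering, then `T`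
has a periodic point of minimal period `k`. -/
theorem triMap_sharkovsky (f : I → I) (g : I × I → I)
    (hf : Continuous f) (hg : Continuous g)
    (m k : ℕ) (z : I × I)
    (hm : MinPeriod (triMap f g) z m)
    (hmk : SharkGt m k) :
    ∃ w : I × I, MinPeriod (triMap f g) w k := by
  suffices h : HasMinPeriod (triMap f g) k by
    obtain ⟨w, hw⟩ := h
    exact ⟨w, minPeriod_iff.2 ⟨hmk.pos, hw⟩⟩
  obtain ⟨hm0, rfl⟩ := minPeriod_iff.1 hm
  obtain ⟨x, y⟩ := z
  rw [minimalPeriod_triMap] at hm0 hmk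
  have hp := Nat.pos_of_mul_pos_right hm0
  have hq := Nat.pos_of_mul_pos_left hm0
  rcases hmk.of_mul hp hq with rfl | h | ⟨r, rfl, h⟩
  · exact HasMinPeriod.triMap hf hg ⟨x, rfl⟩
  · exact (sharkovsky_unitInterval hf hp h ⟨x, rfl⟩).triMap hf hg
  · obtain ⟨y', hy'⟩ := sharkovsky_unitInterval (continuous_fibreMap hf hg _ x) hq h ⟨y, rfl⟩
    exact ⟨(x, y'), by rw [minimalPeriod_triMap, hy']⟩
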